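/- arXiv:1610.05627 — 3 statements merged into one kernel-verified Lean document; each statement's English description precedes it below -/
import Mathlib

section
/- Fix q ∈ (1,∞] and let p satisfy 1/p + 1/q = 1. Take the square loss l(x,y;β) = (y − βᵀx)^2 and the cost c((x,y),(u,v)) = ‖(x,y) − (u,v)‖_q^2. Then for every δ > 0, min_{β ∈ ℝ^d} sup { E_P[l(X,Y;β)] : D_c(P,P_n) ≤ δ } = min_{β ∈ ℝ^d} ( √(MSE_n(β)) + √δ · ‖β̄‖_p )^2, where β̄ = (−β, 1) ∈ ℝ^{d+1} and MSE_n(β) = (1/n) Σ_{i=1}^n (Y_i − βᵀX_i)^2. -/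
open MeasureTheory ProbabilityTheory Filter
open scoped ENNReal NNReal Topology

noncomputable section

/-- The ℓ_p norm on `Fin d → ℝ`, for `p ∈ [1,∞]`. -/
def lpNorm (p : ℝ≥0∞) {d : ℕ} (x : Fin d → ℝ) : ℝ :=
  if p = ⊤ then ⨆ i, |x i| else (∑ i, |x i| ^ p.toReal) ^ (1 / p.toReal)

/-- Optimal transport discrepancy with cost `c`. -/
def OTCost {α : Type*} [MeasurableSpace α] (c : α → α → ℝ≥0∞) (P Q : Measure α) : ℝ≥0∞ :=
  ⨅ (π : Measure (α × α)) (_ : IsProbabilityMeasure π) (_ : π.map Prod.fst = P)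
    (_ : π.map Prod.snd = Q), ∫⁻ z, c z.1 z.2 ∂π

/-- Empirical measure of the points `W 0, …, W (n-1)`. -/
def empMeas {α : Type*} [MeasurableSpace α] {n : ℕ} (W : Fin n → α) : Measure α :=
  (n : ℝ≥0∞)⁻¹ • ∑ i, Measure.dirac (W i)

/-- Extended-real-valued expectation `E_P[l]`, defined via positive and negative parts. -/
def eExp {α : Type*} [MeasurableSpace α] (P : Measure α) (l : α → ℝ) : EReal :=
  ((∫⁻ z, ENNReal.ofReal (l z) ∂P : ℝ≥0∞) : EReal)
    - ((∫⁻ z, ENNReal.ofReal (-(l z)) ∂P : ℝ≥0∞) : EReal)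

theorem lpNorm_nonneg (p : ℝ≥0∞) {k : ℕ} (x : Fin k → ℝ) : 0 ≤ lpNorm p x := by
  unfold _root_.lpNorm
  split_ifs
  · exact Real.iSup_nonneg fun i => abs_nonneg _
  · positivity

theorem holderConjugate_cases {p q : ℝ≥0∞} (hq : 1 < q) (hpq : p⁻¹ + q⁻¹ = 1) :
    (p = 1 ∧ q = ⊤) ∨ (p ≠ ⊤ ∧ q ≠ ⊤ ∧ p.toReal.HolderConjugate q.toReal) := by
  by_cases hqt : q = ⊤
  · left
    subst hqt
    simpa using hpq
  · right
    have hpt : p ≠ ⊤ := by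
      rintro rfl
      simp at hpq
      exact hq.ne' hpq
    have : ENNReal.HolderConjugate p q := ENNReal.holderConjugate_iff.2 hpq
    exact ⟨hpt, hqt, ENNReal.HolderConjugate.toReal_of_ne_top hpt hqt⟩

/-- Hölder's inequality for `lpNorm`. -/
theorem abs_sum_mul_le_lpNorm_mul_lpNorm {p q : ℝ≥0∞} (hq : 1 < q) (hpq : p⁻¹ + q⁻¹ = 1)
    {k : ℕ} (b w : Fin k → ℝ) : |∑ i, b i * w i| ≤ lpNorm p b * lpNorm q w := by
  have habs : |∑ i, b i * w i| ≤ ∑ i, |b i| * |w i| :=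
    (Finset.abs_sum_le_sum_abs _ _).trans_eq (by simp [abs_mul])
  refine habs.trans ?_
  rcases holderConjugate_cases hq hpq with ⟨rfl, rfl⟩ | ⟨hpt, hqt, h⟩
  · simp only [_root_.lpNorm, ENNReal.one_ne_top, if_false, if_true, ENNReal.toReal_one,
      Real.rpow_one, div_one, Finset.sum_mul]
    gcongr with i
    exact le_ciSup (f := fun i => |w i|) (Set.finite_range _).bddAbove i
  · simp only [_root_.lpNorm, hpt, hqt, if_false]
    simpa using Real.inner_le_Lp_mul_Lq Finset.univ (fun i => |b i|) (fun i => |w i|) h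

theorem lpNorm_smul_le {q : ℝ≥0∞} (hq : 1 < q) {k : ℕ} (t : ℝ) (v : Fin k → ℝ) :
    lpNorm q (fun i => t * v i) ≤ |t| * lpNorm q v := by
  unfold _root_.lpNorm
  split_ifs with hqt
  · refine Real.iSup_le (fun i => ?_) (mul_nonneg (abs_nonneg t)
      (Real.iSup_nonneg fun i => abs_nonneg _))
    rw [abs_mul]
    gcongr
    exact le_ciSup (f := fun i => |v i|) (Set.finite_range _).bddAbove i
  · have h0 : q.toReal ≠ 0 := (ENNReal.toReal_pos (zero_lt_one.trans hq).ne' hqt).ne'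
    have : ∀ i, |t * v i| ^ q.toReal = |t| ^ q.toReal * |v i| ^ q.toReal := fun i => by
      rw [abs_mul, Real.mul_rpow (abs_nonneg _) (abs_nonneg _)]
    simp only [this, ← Finset.mul_sum]
    rw [Real.mul_rpow (by positivity) (by positivity), ← Real.rpow_mul (abs_nonneg _),
      mul_one_div_cancel h0, Real.rpow_one]

/-- The dual norm is attained: equality in Hölder's inequality. -/
theorem exists_lpNorm_le_one_sum_mul_eq {p q : ℝ≥0∞} (hq : 1 < q) (hpq : p⁻¹ + q⁻¹ = 1)
    {k : ℕ} (b : Fin k → ℝ) :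
    ∃ v : Fin k → ℝ, lpNorm q v ≤ 1 ∧ ∑ i, b i * v i = lpNorm p b := by
  have hsign : ∀ x : ℝ, ∃ s : ℝ, |s| = 1 ∧ x * s = |x| := fun x => by
    rcases le_total 0 x with hx | hx
    · exact ⟨1, by simp, by simp [abs_of_nonneg hx]⟩
    · exact ⟨-1, by simp, by simp [abs_of_nonpos hx]⟩
  choose s hs hsx using hsign
  rcases holderConjugate_cases hq hpq with ⟨rfl, rfl⟩ | ⟨hpt, hqt, h⟩
  · refine ⟨fun i => s (b i), ?_, ?_⟩
    · simp only [_root_.lpNorm, if_true, hs]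
      exact Real.iSup_le (fun _ => le_rfl) zero_le_one
    · simp [_root_.lpNorm, hsx]
  · obtain ⟨g, hg, hgeq⟩ := (NNReal.isGreatest_Lp Finset.univ (fun i => Real.nnabs (b i)) h).1
    refine ⟨fun i => s (b i) * g i, ?_, ?_⟩
    · simp only [_root_.lpNorm, hqt, if_false, abs_mul, hs, one_mul, NNReal.abs_eq]
      refine Real.rpow_le_one (by positivity) ?_ (by positivity)
      exact_mod_cast hg
    · simp only [_root_.lpNorm, hpt, if_false, ← mul_assoc, hsx]
      have := congrArg ((↑) : ℝ≥0 → ℝ) hgeq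
      push_cast at this
      simpa using this

theorem lintegral_empMeas {α : Type*} [MeasurableSpace α] [MeasurableSingletonClass α] {n : ℕ}
    (W : Fin n → α) (f : α → ℝ≥0∞) :
    ∫⁻ z, f z ∂(empMeas W) = (n : ℝ≥0∞)⁻¹ * ∑ i, f (W i) := by
  simp [empMeas, lintegral_smul_measure, lintegral_finsetSum_measure]

theorem lintegral_ofReal_empMeas {α : Type*} [MeasurableSpace α] [MeasurableSingletonClass α]
    {n : ℕ} (hn : 0 < n) (W : Fin n → α) {f : α → ℝ} (hf : ∀ z, 0 ≤ f z) :
    ∫⁻ z, ENNReal.ofReal (f z) ∂(empMeas W)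
      = ENNReal.ofReal ((n : ℝ)⁻¹ * ∑ i, f (W i)) := by
  rw [lintegral_empMeas, ENNReal.ofReal_mul (by positivity),
    ENNReal.ofReal_sum_of_nonneg (fun i _ => hf _),
    ENNReal.ofReal_inv_of_pos (by exact_mod_cast hn), ENNReal.ofReal_natCast]

theorem isProbabilityMeasure_empMeas {α : Type*} [MeasurableSpace α] {n : ℕ} (hn : 0 < n)
    (W : Fin n → α) : IsProbabilityMeasure (empMeas W) := by
  constructor
  simp [empMeas, ENNReal.inv_mul_cancel, hn.ne']

theorem map_empMeas {α β : Type*} [MeasurableSpace α] [MeasurableSpace β] {n : ℕ}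
    (W : Fin n → α) {f : α → β} (hf : Measurable f) :
    (empMeas W).map f = empMeas (fun i => f (W i)) := by
  simp [empMeas, Measure.map_smul, Measure.map_finset_sum hf.aemeasurable, Measure.map_dirac' hf]

theorem eExp_of_nonneg {α : Type*} [MeasurableSpace α] (P : Measure α) {l : α → ℝ}
    (hl : ∀ z, 0 ≤ l z) : eExp P l = ((∫⁻ z, ENNReal.ofReal (l z) ∂P : ℝ≥0∞) : EReal) := by
  have : ∀ z, ENNReal.ofReal (-(l z)) = 0 := fun z => ENNReal.ofReal_of_nonpos (by simpa using hl z)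
  simp [eExp, this]

/-- Minkowski's inequality along a coupling. -/
theorem lintegral_sq_map_fst_le {α : Type*} [MeasurableSpace α] {π : Measure (α × α)}
    {φ : α → ℝ} (hφ : Measurable φ) {M T : ℝ} (hM : 0 ≤ M) (hT : 0 ≤ T)
    (h2 : ∫⁻ z, ENNReal.ofReal (φ z ^ 2) ∂(π.map Prod.snd) ≤ ENNReal.ofReal M)
    (hd : ∫⁻ z, ENNReal.ofReal ((φ z.1 - φ z.2) ^ 2) ∂π ≤ ENNReal.ofReal T) :
    ∫⁻ z, ENNReal.ofReal (φ z ^ 2) ∂(π.map Prod.fst)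
      ≤ ENNReal.ofReal ((√M + √T) ^ 2) := by
  rw [lintegral_map (by fun_prop) measurable_snd] at h2
  rw [lintegral_map (by fun_prop) measurable_fst]
  have hsq : ∀ x : ℝ, ENNReal.ofReal (x ^ 2) = ENNReal.ofReal |x| ^ (2 : ℝ) := fun x => by
    rw [← sq_abs, ENNReal.ofReal_pow (abs_nonneg _), ← ENNReal.rpow_natCast]
    norm_num
  have hrt : ∀ {x : ℝ}, 0 ≤ x → ENNReal.ofReal x ^ (1 / 2 : ℝ) = ENNReal.ofReal √x
      := fun {x} hx => by
    rw [ENNReal.ofReal_rpow_of_nonneg hx (by norm_num), Real.sqrt_eq_rpow]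
  simp only [hsq] at h2 hd ⊢
  have hmink := ENNReal.lintegral_Lp_add_le (μ := π) (p := 2)
    (f := fun z : α × α => ENNReal.ofReal |φ z.2|)
    (g := fun z : α × α => ENNReal.ofReal |φ z.1 - φ z.2|)
    (by fun_prop) (by fun_prop) (by norm_num)
  have hle : ∫⁻ z, ENNReal.ofReal |φ z.1| ^ (2 : ℝ) ∂π ≤
      ∫⁻ z, ((fun z : α × α => ENNReal.ofReal |φ z.2|) +
        (fun z : α × α => ENNReal.ofReal |φ z.1 - φ z.2|)) z ^ (2 : ℝ) ∂π := by
    refine lintegral_mono fun z => ENNReal.rpow_le_rpow ?_ (by norm_num)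
    simp only [Pi.add_apply]
    rw [← ENNReal.ofReal_add (abs_nonneg _) (abs_nonneg _)]
    refine ENNReal.ofReal_le_ofReal ?_
    simpa using abs_add_le (φ z.2) (φ z.1 - φ z.2)
  have hroot : (∫⁻ z, ENNReal.ofReal |φ z.1| ^ (2 : ℝ) ∂π) ^ (1 / 2 : ℝ)
      ≤ ENNReal.ofReal |√M + √T| := by
    refine (ENNReal.rpow_le_rpow hle (by norm_num)).trans (hmink.trans ?_)
    rw [abs_of_nonneg (by positivity), ENNReal.ofReal_add (by positivity) (by positivity),
      ← hrt hM, ← hrt hT]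
    gcongr
  have := ENNReal.rpow_le_rpow hroot (zero_le_two (α := ℝ))
  rwa [← ENNReal.rpow_mul, one_div_mul_cancel two_ne_zero, ENNReal.rpow_one] at this

theorem sum_snoc_mul_snoc {d : ℕ} (β x : Fin d → ℝ) (y : ℝ) :
    ∑ i : Fin (d + 1), (Fin.snoc (-β) 1 : Fin (d + 1) → ℝ) i * (Fin.snoc x y : Fin (d + 1) → ℝ) i
      = y - ∑ j, β j * x j := by
  simp [Fin.sum_univ_castSucc]
  ring

section Regression

variable {d n : ℕ} {q p : ℝ≥0∞} {X : Fin n → (Fin d → ℝ)} {Y : Fin n → ℝ}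
  {c : ((Fin d → ℝ) × ℝ) → ((Fin d → ℝ) × ℝ) → ℝ≥0∞} {δ : ℝ}

/-- Upper bound on the worst-case risk over the ambiguity set. -/
theorem lintegral_sq_residual_le (hn : 0 < n) (hq : 1 < q) (hpq : p⁻¹ + q⁻¹ = 1)
    (hc : ∀ x y u v, c (x, y) (u, v) =
      ENNReal.ofReal (lpNorm q (Fin.snoc (x - u) (y - v) : Fin (d + 1) → ℝ) ^ 2))
    (hδ : 0 < δ) (β : Fin d → ℝ) (P : Measure ((Fin d → ℝ) × ℝ))
    (hP : OTCost c P (empMeas (fun i => (X i, Y i))) ≤ ENNReal.ofReal δ) :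
    ∫⁻ z, ENNReal.ofReal ((z.2 - ∑ j, β j * z.1 j) ^ 2) ∂P ≤
      ENNReal.ofReal ((√((n : ℝ)⁻¹ * ∑ i, (Y i - ∑ j, β j * X i j) ^ 2)
        + √δ * lpNorm p (Fin.snoc (-β) 1 : Fin (d + 1) → ℝ)) ^ 2) := by
  set L := lpNorm p (Fin.snoc (-β) 1 : Fin (d + 1) → ℝ) with hL
  have hL0 : 0 ≤ L := lpNorm_nonneg _ _
  set M := (n : ℝ)⁻¹ * ∑ i, (Y i - ∑ j, β j * X i j) ^ 2 with hMdef
  have hM : 0 ≤ M := by positivity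
  have key : ∀ δ' > δ, ∫⁻ z, ENNReal.ofReal ((z.2 - ∑ j, β j * z.1 j) ^ 2) ∂P ≤
      ENNReal.ofReal ((√M + √δ' * L) ^ 2) := by
    intro δ' hδ'
    have hδ0 : 0 < δ' := hδ.trans hδ'
    have hlt := hP.trans_lt ((ENNReal.ofReal_lt_ofReal_iff hδ0).2 hδ')
    simp only [OTCost, iInf_lt_iff] at hlt
    obtain ⟨π, hπ, hfst, hsnd, hcost⟩ := hlt
    have hpt : ∀ z : ((Fin d → ℝ) × ℝ) × ((Fin d → ℝ) × ℝ),
        ENNReal.ofReal (((z.1.2 - ∑ j, β j * z.1.1 j) - (z.2.2 - ∑ j, β j * z.2.1 j)) ^ 2) ≤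
          ENNReal.ofReal (L ^ 2) * c z.1 z.2 := by
      rintro ⟨⟨x, y⟩, u, v⟩
      rw [hc, ← ENNReal.ofReal_mul (by positivity), ← mul_pow]
      refine ENNReal.ofReal_le_ofReal ?_
      rw [← sq_abs]
      have := abs_sum_mul_le_lpNorm_mul_lpNorm hq hpq (Fin.snoc (-β) 1 : Fin (d + 1) → ℝ)
        (Fin.snoc (x - u) (y - v))
      rw [sum_snoc_mul_snoc] at this
      refine pow_le_pow_left₀ (abs_nonneg _) (le_of_eq_of_le (congrArg _ ?_) this) 2
      simp only [Pi.sub_apply, mul_sub, Finset.sum_sub_distrib]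
      ring
    have hd : ∫⁻ z, ENNReal.ofReal
        (((z.1.2 - ∑ j, β j * z.1.1 j) - (z.2.2 - ∑ j, β j * z.2.1 j)) ^ 2) ∂π ≤
          ENNReal.ofReal (L ^ 2 * δ') := by
      refine (lintegral_mono hpt).trans ?_
      rw [lintegral_const_mul' _ _ ENNReal.ofReal_ne_top, ENNReal.ofReal_mul (by positivity)]
      gcongr
    have := lintegral_sq_map_fst_le (φ := fun z : (Fin d → ℝ) × ℝ => z.2 - ∑ j, β j * z.1 j)
      (by fun_prop) hM (by positivity)
      (by rw [hsnd, lintegral_ofReal_empMeas hn _ (fun z => sq_nonneg _)]) hd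
    rwa [hfst, Real.sqrt_mul (sq_nonneg _), Real.sqrt_sq hL0, mul_comm L] at this
  have hcont : Continuous fun t : ℝ => ENNReal.ofReal ((√M + √t * L) ^ 2) :=
    ENNReal.continuous_ofReal.comp (by fun_prop)
  exact ge_of_tendsto (hcont.continuousWithinAt (s := Set.Ioi δ) (x := δ))
    (eventually_mem_nhdsWithin.mono key)

/-- Translating the data along one direction, with `t i ^ 2` of average at most `δ`, stays inside
the ambiguity set. -/
theorem OTCost_translate_le (hn : 0 < n) (hq : 1 < q)
    (hc : ∀ x y u v, c (x, y) (u, v) =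
      ENNReal.ofReal (lpNorm q (Fin.snoc (x - u) (y - v) : Fin (d + 1) → ℝ) ^ 2))
    {v : Fin (d + 1) → ℝ} (hv : lpNorm q v ≤ 1) {t : Fin n → ℝ}
    (ht : (n : ℝ)⁻¹ * ∑ i, t i ^ 2 ≤ δ) :
    OTCost c (empMeas fun i => (fun j => X i j + t i * v (Fin.castSucc j),
        Y i + t i * v (Fin.last d)))
      (empMeas (fun i => (X i, Y i))) ≤ ENNReal.ofReal δ := by
  set U : Fin n → (Fin d → ℝ) × ℝ := fun i => (fun j => X i j + t i * v (Fin.castSucc j),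
        Y i + t i * v (Fin.last d)) with hU
  refine (iInf_le_of_le (empMeas fun i => (U i, (X i, Y i))) <|
    iInf_le_of_le (isProbabilityMeasure_empMeas hn _) <|
    iInf_le_of_le (map_empMeas _ measurable_fst) <|
    iInf_le_of_le (map_empMeas _ measurable_snd) le_rfl).trans ?_
  rw [lintegral_empMeas]
  have hcost : ∀ i, c (U i) (X i, Y i) ≤ ENNReal.ofReal (t i ^ 2) := by
    intro i
    rw [hU, hc]
    refine ENNReal.ofReal_le_ofReal ?_
    have hvec : (Fin.snoc ((fun j => X i j + t i * v (Fin.castSucc j)) - X i)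
        (Y i + t i * v (Fin.last d) - Y i) : Fin (d + 1) → ℝ) = fun k => t i * v k := by
      funext k
      refine Fin.lastCases ?_ (fun j => ?_) k <;> simp
    rw [hvec, ← sq_abs (t i)]
    refine pow_le_pow_left₀ (lpNorm_nonneg _ _) ((lpNorm_smul_le hq _ _).trans ?_) 2
    exact mul_le_of_le_one_right (abs_nonneg _) hv
  calc (n : ℝ≥0∞)⁻¹ * ∑ i, c (U i) (X i, Y i)
      ≤ (n : ℝ≥0∞)⁻¹ * ∑ i, ENNReal.ofReal (t i ^ 2) := by
        gcongr with i
        exact hcost i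
    _ = ENNReal.ofReal ((n : ℝ)⁻¹ * ∑ i, t i ^ 2) := by
        rw [← lintegral_empMeas t fun x => ENNReal.ofReal (x ^ 2),
          lintegral_ofReal_empMeas hn t fun x => sq_nonneg x]
    _ ≤ ENNReal.ofReal δ := ENNReal.ofReal_le_ofReal ht

/-- Optimal step sizes: residuals can be inflated uniformly with average squared step `δ`. -/
theorem exists_steps (hn : 0 < n) (hδ : 0 < δ) (r : Fin n → ℝ) (L : ℝ) :
    ∃ t : Fin n → ℝ, (n : ℝ)⁻¹ * ∑ i, t i ^ 2 = δ ∧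
      (n : ℝ)⁻¹ * ∑ i, (r i + t i * L) ^ 2 = (√((n : ℝ)⁻¹ * ∑ i, r i ^ 2) + √δ * L) ^ 2 := by
  have hn0 : (n : ℝ) ≠ 0 := by exact_mod_cast hn.ne'
  have hδs := Real.sq_sqrt hδ.le
  set M := (n : ℝ)⁻¹ * ∑ i, r i ^ 2 with hMdef
  have hM : 0 ≤ M := by positivity
  rcases hM.eq_or_lt with h0 | hpos
  · have hr : ∀ i, r i = 0 := by
      have : ∑ i, r i ^ 2 = 0 := by
        rcases mul_eq_zero.1 (hMdef.symm.trans h0.symm) with h | h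
        · exact absurd h (inv_ne_zero hn0)
        · exact h
      intro i
      simpa using (Finset.sum_eq_zero_iff_of_nonneg fun i _ => sq_nonneg (r i)).1 this i
    refine ⟨fun _ => √δ, ?_, ?_⟩
    · simp [hδs, hn0]
    · simp [hr, ← h0, hn0]
  · have hs : √M ≠ 0 := (Real.sqrt_pos.2 hpos).ne'
    have hMs := Real.sq_sqrt hM
    have hscale : ∀ a : ℝ, (n : ℝ)⁻¹ * ∑ i, (a * r i) ^ 2 = (a * √M) ^ 2 := fun a => by
      rw [mul_pow, hMs, hMdef]
      simp only [mul_pow, ← Finset.mul_sum]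
      ring
    refine ⟨fun i => √δ / √M * r i, ?_, ?_⟩
    · rw [hscale, div_mul_cancel₀ _ hs, hδs]
    · have : ∀ i, r i + √δ / √M * r i * L = (1 + √δ / √M * L) * r i := fun i => by ring
      simp only [this]
      rw [hscale]
      congr 1
      field_simp

/-- Worst-case expected square loss over the optimal transport ball, for fixed `β`. -/
theorem iSup_eExp_sq_residual (hn : 0 < n) (hq : 1 < q) (hpq : p⁻¹ + q⁻¹ = 1)
    (hc : ∀ x y u v, c (x, y) (u, v) =
      ENNReal.ofReal (lpNorm q (Fin.snoc (x - u) (y - v) : Fin (d + 1) → ℝ) ^ 2))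
    (hδ : 0 < δ) (β : Fin d → ℝ) :
    (⨆ (P : Measure ((Fin d → ℝ) × ℝ)) (_ : IsProbabilityMeasure P)
      (_ : OTCost c P (empMeas (fun i => (X i, Y i))) ≤ ENNReal.ofReal δ),
      eExp P (fun z => (z.2 - ∑ j, β j * z.1 j) ^ 2))
    = (((√((n : ℝ)⁻¹ * ∑ i, (Y i - ∑ j, β j * X i j) ^ 2)
        + √δ * lpNorm p (Fin.snoc (-β) 1 : Fin (d + 1) → ℝ)) ^ 2 : ℝ) : EReal) := by
  have hcoe : ∀ x : ℝ, ((ENNReal.ofReal (x ^ 2) : ℝ≥0∞) : EReal) = ((x ^ 2 : ℝ) : EReal) :=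
    fun x => by rw [EReal.coe_ennreal_ofReal, max_eq_left (sq_nonneg x)]
  apply le_antisymm
  · refine iSup_le fun P => iSup_le fun _ => iSup_le fun hP => ?_
    rw [eExp_of_nonneg _ (fun z => sq_nonneg _), ← hcoe]
    exact EReal.coe_ennreal_le_coe_ennreal_iff.2 (lintegral_sq_residual_le hn hq hpq hc hδ β P hP)
  · obtain ⟨v, hv, hbv⟩ := exists_lpNorm_le_one_sum_mul_eq hq hpq
      (Fin.snoc (-β) 1 : Fin (d + 1) → ℝ)
    obtain ⟨t, ht, hrisk⟩ := exists_steps hn hδ (fun i => Y i - ∑ j, β j * X i j)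
      (lpNorm p (Fin.snoc (-β) 1 : Fin (d + 1) → ℝ))
    refine le_iSup_of_le _ <| le_iSup_of_le (isProbabilityMeasure_empMeas hn _) <|
      le_iSup_of_le (OTCost_translate_le hn hq hc hv ht.le) ?_
    rw [eExp_of_nonneg _ (fun z => sq_nonneg _), lintegral_ofReal_empMeas hn _
      (fun z => sq_nonneg _), ← hcoe, ← hrisk]
    refine le_of_eq ?_
    congr 5
    funext i
    rw [← hbv, Fin.sum_univ_castSucc]
    simp only [Fin.snoc_castSucc, Fin.snoc_last, Pi.neg_apply, mul_add, Finset.sum_add_distrib,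
      Finset.mul_sum]
    have : ∑ j, β j * (t i * v (Fin.castSucc j)) = - ∑ j, t i * (-β j * v (Fin.castSucc j)) := by
      rw [← Finset.sum_neg_distrib]
      exact Finset.sum_congr rfl fun j _ => by ring
    rw [this]
    ring

end Regression

/-- distributionally robust representation of linear regression with square
loss `l(x,y;β) = (y - βᵀx)²` and cost `c((x,y),(u,v)) = ‖(x,y)-(u,v)‖_q²` with
`q ∈ (1,∞]`, `1/p + 1/q = 1`: for every `δ > 0`,
`min_β sup { E_P[l(X,Y;β)] : D_c(P,P_n) ≤ δ } = min_β ( √(MSE_n(β)) + √δ ‖(-β,1)‖_p )²`. -/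
theorem dr_linear_regression_representation
    (d n : ℕ) (hn : 0 < n)
    (q p : ℝ≥0∞) (hq : 1 < q) (hpq : p⁻¹ + q⁻¹ = 1)
    (X : Fin n → (Fin d → ℝ)) (Y : Fin n → ℝ)
    (c : ((Fin d → ℝ) × ℝ) → ((Fin d → ℝ) × ℝ) → ℝ≥0∞)
    (hc : ∀ x y u v, c (x, y) (u, v) =
      ENNReal.ofReal (lpNorm q (Fin.snoc (x - u) (y - v)) ^ 2))
    (δ : ℝ) (hδ : 0 < δ) :
    (⨅ β : Fin d → ℝ,
        ⨆ (P : Measure ((Fin d → ℝ) × ℝ)) (_ : IsProbabilityMeasure P)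
          (_ : OTCost c P (empMeas (fun i => (X i, Y i))) ≤ ENNReal.ofReal δ),
          eExp P (fun z => (z.2 - ∑ j, β j * z.1 j) ^ 2))
      = ((⨅ β : Fin d → ℝ,
            (Real.sqrt ((n : ℝ)⁻¹ * ∑ i, (Y i - ∑ j, β j * X i j) ^ 2)
              + Real.sqrt δ * lpNorm p (Fin.snoc (-β) 1)) ^ 2 : ℝ) : EReal) := by
  simp only [iSup_eExp_sq_residual hn hq hpq hc hδ]
  exact (Monotone.map_ciInf_of_continuousAt continuous_coe_real_ereal.continuousAt
    (fun _ _ h => EReal.coe_le_coe_iff.2 h)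
    ⟨0, Set.forall_mem_range.2 fun _ => sq_nonneg _⟩).symm
end
end

section
/- In the settings of the distributionally robust representations for generalized LASSO (square loss l(x,y;β) = (y−βᵀx)^2 with cost c = N_q^2) and for regularized logistic regression (log-exponential loss l(x,y;β) = log(1+exp(−yβᵀx)) with cost c = N_q), if E‖X‖_2^2 < ∞, then for every δ > 0 the min–max equals the max–min: inf_{β ∈ ℝ^d} sup_{P : D_c(P,P_n) ≤ δ} E_P[l(X,Y;β)] = sup_{P : D_c(P,P_n) ≤ δ} inf_{β ∈ ℝ^d} E_P[l(X,Y;β)]. -/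
open MeasureTheory ProbabilityTheory Filter
open scoped ENNReal NNReal Topology

noncomputable section

/-- Finite minimax for convex functions: if a finite family of convex functions has pointwise
maximum at least `T` on `C`, then so does one of its convex combinations. -/
theorem exists_stdSimplex_le_sum_of_convexOn {E ι : Type*} [AddCommGroup E] [Module ℝ E]
    [Fintype ι] [Nonempty ι] {C : Set E} {g : ι → E → ℝ} (hC : Convex ℝ C)
    (hg : ∀ i, ConvexOn ℝ C (g i)) {T : ℝ} (hT : ∀ x ∈ C, ∃ i, T ≤ g i x) :
    ∃ w ∈ stdSimplex ℝ ι, ∀ x ∈ C, T ≤ ∑ i, w i * g i x := by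
  classical
  rcases C.eq_empty_or_nonempty with rfl | ⟨x₀, hx₀⟩
  · obtain ⟨i⟩ := ‹Nonempty ι›
    exact ⟨Pi.single i 1, single_mem_stdSimplex ℝ i, by simp⟩
  set A : Set (ι → ℝ) := {r | ∃ x ∈ C, ∀ i, g i x ≤ r i} with hA
  set B : Set (ι → ℝ) := Set.univ.pi fun _ => Set.Iio T with hB
  have hAconv : Convex ℝ A := by
    rintro r ⟨x, hx, hr⟩ s ⟨y, hy, hs⟩ a b ha hb hab
    refine ⟨a • x + b • y, hC hx hy ha hb hab, fun i => ?_⟩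
    refine ((hg i).2 hx hy ha hb hab).trans ?_
    simp only [Pi.add_apply, Pi.smul_apply, smul_eq_mul]
    gcongr
    exacts [hr i, hs i]
  have hBconv : Convex ℝ B := convex_pi fun _ _ => convex_Iio T
  have hBopen : IsOpen B := isOpen_set_pi Set.finite_univ fun _ _ => isOpen_Iio
  have hdisj : Disjoint B A := by
    rw [Set.disjoint_left]
    rintro r hr ⟨x, hx, h⟩
    obtain ⟨i, hi⟩ := hT x hx
    exact absurd (hr i trivial) (not_lt.2 (hi.trans (h i)))
  obtain ⟨φ, s, hφB, hφA⟩ := geometric_hahn_banach_open hBconv hBopen hAconv hdisj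
  set c : ι → ℝ := fun i => φ (Pi.single i 1) with hc
  have hφ : ∀ r : ι → ℝ, φ r = ∑ i, c i * r i := fun r => by
    conv_lhs => rw [← Finset.univ_sum_single r, map_sum]
    refine Finset.sum_congr rfl fun i _ => ?_
    rw [show (Pi.single i (r i) : ι → ℝ) = r i • Pi.single i 1 by
      rw [← Pi.single_smul]; simp, map_smul, smul_eq_mul, mul_comm]
  have hr₀ : (fun i => g i x₀) ∈ A := ⟨x₀, hx₀, fun _ => le_rfl⟩
  have hc0 : ∀ i, 0 ≤ c i := by
    intro i
    by_contra! hi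
    have key : ∀ N : ℝ, 0 ≤ N → (T - 1) * ∑ j, c j - N * c i < s := by
      intro N hN
      have := hφB ((fun _ => T - 1) - N • Pi.single i 1) (by
        intro j _
        by_cases hj : j = i
        · subst hj; simp; linarith
        · simp [hj])
      rw [map_sub, map_smul, hφ, ← Finset.sum_mul, smul_eq_mul] at this
      linarith
    have h0 := key 0 le_rfl
    have := key ((s - (T - 1) * ∑ j, c j) / (-c i)) (div_nonneg (by linarith) (by linarith))
    have h2 : (s - (T - 1) * ∑ j, c j) / (-c i) * c i = -(s - (T - 1) * ∑ j, c j) := by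
      rw [div_neg, neg_mul, div_mul_cancel₀ _ hi.ne]
    linarith
  have hTs : ∀ t < T, t * ∑ j, c j < s := fun t ht => by
    have := hφB (fun _ => t) (fun _ _ => ht)
    rwa [hφ, ← Finset.sum_mul, mul_comm] at this
  have hpos : 0 < ∑ j, c j := by
    refine (Finset.sum_nonneg fun j _ => hc0 j).lt_of_ne' fun h => ?_
    have hz : ∀ j, c j = 0 := fun j =>
      (Finset.sum_eq_zero_iff_of_nonneg fun j _ => hc0 j).1 h j (Finset.mem_univ j)
    have h1 := hTs (T - 1) (by linarith)
    have h2 := hφA _ hr₀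
    rw [hφ] at h2
    simp only [hz, zero_mul, Finset.sum_const_zero, mul_zero] at h1 h2
    linarith
  refine ⟨fun i => c i / ∑ j, c j, ⟨fun i => div_nonneg (hc0 i) hpos.le, ?_⟩, fun x hx => ?_⟩
  · rw [← Finset.sum_div, div_self hpos.ne']
  · have h1 := hφA _ (show (fun i => g i x) ∈ A from ⟨x, hx, fun _ => le_rfl⟩)
    rw [hφ] at h1
    have h2 : ∑ i, c i / (∑ j, c j) * g i x = (∑ i, c i * g i x) / ∑ j, c j := by
      rw [Finset.sum_div]; exact Finset.sum_congr rfl fun i _ => by ring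
    rw [h2]
    refine le_of_forall_lt fun t ht => ?_
    rw [lt_div_iff₀ hpos]
    exact (hTs t ht).trans_le h1

/-- Finite minimax for convex functions with values in `[0, ∞]`. -/
theorem exists_stdSimplex_le_sum_of_convex_ennreal {E ι : Type*} [AddCommGroup E] [Module ℝ E]
    [Fintype ι] {f : ι → E → ℝ≥0∞}
    (hf : ∀ i x y (a b : ℝ), 0 ≤ a → 0 ≤ b → a + b = 1 →
      f i (a • x + b • y) ≤ ENNReal.ofReal a * f i x + ENNReal.ofReal b * f i y)
    {S T : ℝ} (hS : 0 ≤ S) (hST : S < T) (hT : ∀ x, ∃ i, ENNReal.ofReal T < f i x) :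
    ∃ w ∈ stdSimplex ℝ ι, ∀ x, ENNReal.ofReal S ≤ ∑ i, ENNReal.ofReal (w i) * f i x := by
  classical
  have hne : Nonempty ι := ⟨(hT 0).choose⟩
  have hTpos : 0 < T := hS.trans_lt hST
  set C : Set E := {x | ∀ i, f i x ≠ ⊤}
  have hC : Convex ℝ C := by
    intro x hx y hy a b ha hb hab i
    refine ne_top_of_le_ne_top ?_ (hf i x y a b ha hb hab)
    exact ENNReal.add_ne_top.2 ⟨ENNReal.mul_ne_top ENNReal.ofReal_ne_top (hx i),
      ENNReal.mul_ne_top ENNReal.ofReal_ne_top (hy i)⟩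
  have hg : ∀ i, ConvexOn ℝ C fun x => (f i x).toReal := by
    refine fun i => ⟨hC, fun x hx y hy a b ha hb hab => ?_⟩
    have h1 := ENNReal.mul_ne_top (ENNReal.ofReal_ne_top (r := a)) (hx i)
    have h2 := ENNReal.mul_ne_top (ENNReal.ofReal_ne_top (r := b)) (hy i)
    have := ENNReal.toReal_mono (ENNReal.add_ne_top.2 ⟨h1, h2⟩) (hf i x y a b ha hb hab)
    rw [ENNReal.toReal_add h1 h2, ENNReal.toReal_mul, ENNReal.toReal_mul,
      ENNReal.toReal_ofReal ha, ENNReal.toReal_ofReal hb] at this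
    exact this
  obtain ⟨c, hc, hcT⟩ := exists_stdSimplex_le_sum_of_convexOn hC hg (T := T) fun x hx => by
    obtain ⟨i, hi⟩ := hT x
    exact ⟨i, (ENNReal.ofReal_le_iff_le_toReal (hx i)).1 hi.le⟩
  set a : ℝ := S / T
  have ha : 0 ≤ a := div_nonneg hS hTpos.le
  have ha1 : 0 < 1 - a := by
    have : a < 1 := (div_lt_one hTpos).2 hST
    linarith
  have hcard : (0 : ℝ) < Fintype.card ι := by exact_mod_cast Fintype.card_pos
  have hpos : 0 < (1 - a) * (Fintype.card ι : ℝ)⁻¹ := by positivity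
  refine ⟨fun i => a * c i + (1 - a) * (Fintype.card ι : ℝ)⁻¹,
    ⟨fun i => add_nonneg (mul_nonneg ha (hc.1 i)) hpos.le, ?_⟩, fun x => ?_⟩
  · rw [Finset.sum_add_distrib, ← Finset.mul_sum, hc.2]
    simp only [Finset.sum_const, Finset.card_univ, nsmul_eq_mul]
    field_simp
    ring
  by_cases hx : x ∈ C
  · calc ENNReal.ofReal S ≤ ENNReal.ofReal (∑ i, a * c i * (f i x).toReal) := by
          apply ENNReal.ofReal_le_ofReal
          calc S = a * T := by simp only [a]; field_simp
            _ ≤ a * ∑ i, c i * (f i x).toReal := by gcongr; exact hcT x hx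
            _ = _ := by rw [Finset.mul_sum]; exact Finset.sum_congr rfl fun i _ => by ring
      _ = ∑ i, ENNReal.ofReal (a * c i) * f i x := by
          rw [ENNReal.ofReal_sum_of_nonneg fun i _ =>
            mul_nonneg (mul_nonneg ha (hc.1 i)) ENNReal.toReal_nonneg]
          refine Finset.sum_congr rfl fun i _ => ?_
          rw [ENNReal.ofReal_mul (mul_nonneg ha (hc.1 i)), ENNReal.ofReal_toReal (hx i)]
      _ ≤ _ := by
          gcongr with i
          linarith
  · obtain ⟨i, hi⟩ : ∃ i, f i x = ⊤ := by simpa [C] using hx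
    refine le_trans ?_ (Finset.single_le_sum (fun _ _ => zero_le) (Finset.mem_univ i))
    rw [hi, ENNReal.mul_top]
    · exact le_top
    · exact (ENNReal.ofReal_pos.2 (add_pos_of_nonneg_of_pos (mul_nonneg ha (hc.1 i)) hpos)).ne'

theorem isProbabilityMeasure_sum_smul {α ι : Type*} [MeasurableSpace α] [Fintype ι]
    {w : ι → ℝ≥0∞} (hw : ∑ i, w i = 1) (P : ι → Measure α) [∀ i, IsProbabilityMeasure (P i)] :
    IsProbabilityMeasure (∑ i, w i • P i) :=
  ⟨by simp [hw]⟩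

theorem OTCost_sum_smul_le {α ι : Type*} [MeasurableSpace α] [Fintype ι]
    {c : α → α → ℝ≥0∞} {w D : ι → ℝ≥0∞} (hw : ∑ i, w i = 1) {P : ι → Measure α}
    {Q : Measure α} (hD : ∀ i, D i ≠ ⊤) (hP : ∀ i, OTCost c (P i) Q ≤ D i) :
    OTCost c (∑ i, w i • P i) Q ≤ ∑ i, w i * D i := by
  refine ENNReal.le_of_forall_pos_le_add fun ε hε _ => ?_
  have : ∀ i, ∃ π : Measure (α × α), IsProbabilityMeasure π ∧ π.map Prod.fst = P i ∧
      π.map Prod.snd = Q ∧ ∫⁻ z, c z.1 z.2 ∂π ≤ D i + ε := by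
    intro i
    have h : OTCost c (P i) Q < D i + ε :=
      (hP i).trans_lt (ENNReal.lt_add_right (hD i) (by simpa using hε.ne'))
    simp only [OTCost, iInf_lt_iff] at h
    obtain ⟨π, h1, h2, h3, h4⟩ := h
    exact ⟨π, h1, h2, h3, h4.le⟩
  choose π h1 h2 h3 h4 using this
  have hpr := isProbabilityMeasure_sum_smul hw π
  have hmap : ∀ {g : α × α → α}, Measurable g →
      (∑ i, w i • π i).map g = ∑ i, w i • (π i).map g := fun hg => by
    ext s hs
    simp [Measure.map_apply hg hs]
  refine (iInf₂_le_of_le (∑ i, w i • π i) hpr (iInf₂_le_of_le ?_ ?_ le_rfl)).trans ?_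
  · rw [hmap measurable_fst]; simp [h2]
  · rw [hmap measurable_snd]; simp [h3, ← Finset.sum_smul, hw]
  · rw [lintegral_finsetSum_measure]
    calc ∑ i, ∫⁻ z, c z.1 z.2 ∂(w i • π i) ≤ ∑ i, w i * (D i + ε) := by
          gcongr with i
          rw [lintegral_smul_measure, smul_eq_mul]
          gcongr
          exact h4 i
      _ = _ := by simp [mul_add, Finset.sum_add_distrib, ← Finset.sum_mul, hw]

theorem OTCost_empMeas_le {α : Type*} [MeasurableSpace α] [MeasurableSingletonClass α] {n : ℕ}
    (hn : 0 < n) (c : α → α → ℝ≥0∞) (V W : Fin n → α) :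
    OTCost c (empMeas V) (empMeas W) ≤ (n : ℝ≥0∞)⁻¹ * ∑ i, c (V i) (W i) := by
  have hmap : ∀ {g : α × α → α}, Measurable g →
      (empMeas fun i => (V i, W i)).map g = empMeas fun i => g (V i, W i) := fun hg => by
    ext s hs
    simp [empMeas, Measure.map_apply hg hs, Measure.dirac_apply' _ hs,
      Measure.dirac_apply' _ (hg hs), Set.indicator]
    rfl
  refine iInf₂_le_of_le (empMeas fun i => (V i, W i)) (isProbabilityMeasure_empMeas hn _)
    (iInf₂_le_of_le (hmap measurable_fst) (hmap measurable_snd) ?_)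
  simp [empMeas, lintegral_finsetSum_measure]

theorem isClosed_setOf_lintegral_ofReal_le {α E : Type*} [MeasurableSpace α] [TopologicalSpace E]
    [SequentialSpace E] (P : Measure α) {l : E → α → ℝ} (hmeas : ∀ β, Measurable (l β))
    (hcont : ∀ z, Continuous fun β => l β z) (T : ℝ≥0∞) :
    IsClosed {β | ∫⁻ z, ENNReal.ofReal (l β z) ∂P ≤ T} := by
  refine IsSeqClosed.isClosed fun b β hb hlim => ?_
  have hz : ∀ z, ENNReal.ofReal (l β z) = liminf (fun k => ENNReal.ofReal (l (b k) z)) atTop :=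
    fun z => ((ENNReal.continuous_ofReal.comp (hcont z)).continuousAt.tendsto.comp
      hlim).liminf_eq.symm
  calc ∫⁻ z, ENNReal.ofReal (l β z) ∂P
      = ∫⁻ z, liminf (fun k => ENNReal.ofReal (l (b k) z)) atTop ∂P := lintegral_congr hz
    _ ≤ liminf (fun k => ∫⁻ z, ENNReal.ofReal (l (b k) z) ∂P) atTop :=
        lintegral_liminf_le fun k => (hmeas _).ennreal_ofReal
    _ ≤ T := liminf_le_of_frequently_le' (Frequently.of_forall hb)

/-- The optimal transport ball around `empMeas W` contains a measure charging any prescribed point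
that can be reached at finite cost from one of the atoms. -/
theorem exists_mem_OTCost_ball_lintegral_ge {α : Type*} [MeasurableSpace α]
    [MeasurableSingletonClass α] {n : ℕ} (hn : 0 < n) {c : α → α → ℝ≥0∞} {W : Fin n → α}
    (hcW : ∀ i, c (W i) (W i) = 0) {i : Fin n} {z : α} (hz : c z (W i) ≠ ⊤) {δ : ℝ} (hδ : 0 < δ) :
    ∃ P : Measure α, IsProbabilityMeasure P ∧ OTCost c P (empMeas W) ≤ ENNReal.ofReal δ ∧
      ∃ r : ℝ≥0∞, r ≠ 0 ∧ r ≠ ⊤ ∧ ∀ f : α → ℝ≥0∞, r * f z ≤ ∫⁻ x, f x ∂P := by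
  classical
  set V := Function.update W i z with hV
  set D : ℝ≥0∞ := (n : ℝ≥0∞)⁻¹ * ∑ k, c (V k) (W k) with hD
  have hn0 : (n : ℝ≥0∞) ≠ 0 := Nat.cast_ne_zero.2 hn.ne'
  have hDtop : D ≠ ⊤ := by
    refine ENNReal.mul_ne_top (ENNReal.inv_ne_top.2 hn0) (ENNReal.sum_ne_top.2 fun k _ => ?_)
    by_cases hk : k = i
    · subst hk; simpa [hV] using hz
    · simp [hV, hk, hcW]
  set η : ℝ := min 1 (δ / (D.toReal + 1)) with hη
  have hDpos : 0 < D.toReal + 1 := by positivity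
  have hη0 : 0 < η := lt_min one_pos (by positivity)
  have hη1 : η ≤ 1 := min_le_left _ _
  have hηD : η * D.toReal ≤ δ := by
    calc η * D.toReal ≤ δ / (D.toReal + 1) * (D.toReal + 1) := by
          gcongr
          · exact min_le_right _ _
          · linarith
      _ = δ := by field_simp
  let w : Bool → ℝ≥0∞ := fun b => if b then ENNReal.ofReal η else ENNReal.ofReal (1 - η)
  let Q : Bool → Measure α := fun b => if b then empMeas V else empMeas W
  have hw : ∑ b, w b = 1 := by
    simp only [Fintype.sum_bool, w, if_true, Bool.false_eq_true, if_false]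
    rw [← ENNReal.ofReal_add hη0.le (by linarith)]
    simp
  have hQ : ∀ b, IsProbabilityMeasure (Q b) := by
    rintro (_ | _)
    exacts [isProbabilityMeasure_empMeas hn W, isProbabilityMeasure_empMeas hn V]
  refine ⟨∑ b, w b • Q b, isProbabilityMeasure_sum_smul hw Q, ?_,
    ENNReal.ofReal η * (n : ℝ≥0∞)⁻¹, ?_, ?_, fun f => ?_⟩
  · refine (OTCost_sum_smul_le (D := fun b => if b then D else 0) hw ?_ ?_).trans ?_
    · rintro (_ | _)
      exacts [ENNReal.zero_ne_top, hDtop]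
    · rintro (_ | _)
      · exact (OTCost_empMeas_le hn c W W).trans (by simp [hcW])
      · exact OTCost_empMeas_le hn c V W
    · simp only [Fintype.sum_bool, w, if_true, Bool.false_eq_true, if_false, mul_zero, add_zero]
      rw [← ENNReal.ofReal_toReal hDtop, ← ENNReal.ofReal_mul hη0.le]
      exact ENNReal.ofReal_le_ofReal hηD
  · exact mul_ne_zero (ENNReal.ofReal_pos.2 hη0).ne' (by simp)
  · exact ENNReal.mul_ne_top ENNReal.ofReal_ne_top (ENNReal.inv_ne_top.2 hn0)
  · rw [lintegral_finsetSum_measure, Fintype.sum_bool]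
    refine le_trans ?_ le_self_add
    simp only [w, Q, if_true, lintegral_smul_measure, empMeas, lintegral_finsetSum_measure,
      lintegral_dirac, smul_eq_mul]
    rw [mul_assoc]
    gcongr
    refine le_trans ?_ (Finset.single_le_sum (fun _ _ => zero_le) (Finset.mem_univ i))
    simp [hV]

/-- Minimax exchange over an optimal transport ball around an empirical measure, for a nonnegative
loss that is convex and continuous in the decision variable `β`. Coercivity is provided by finitely
many points `a k` that can be reached at finite cost from one of the atoms. -/
theorem iInf_iSup_eExp_eq_iSup_iInf {α ι : Type*} [MeasurableSpace α] [MeasurableSingletonClass α]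
    [Finite ι] {d n : ℕ} (hn : 0 < n) {c : α → α → ℝ≥0∞} {W : Fin n → α}
    (hcW : ∀ i, c (W i) (W i) = 0) {l : (Fin d → ℝ) → α → ℝ} (hl0 : ∀ β z, 0 ≤ l β z)
    (hmeas : ∀ β, Measurable (l β)) (hcont : ∀ z, Continuous fun β => l β z)
    (hconv : ∀ z, ConvexOn ℝ Set.univ fun β => l β z) {i : Fin n} {a : ι → α}
    (ha : ∀ k, c (a k) (W i) ≠ ⊤)
    (hbdd : ∀ T : ℝ, Bornology.IsBounded {β | ∀ k, l β (a k) ≤ T}) {δ : ℝ} (hδ : 0 < δ) :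
    (⨅ β : Fin d → ℝ, ⨆ (P : Measure α) (_ : IsProbabilityMeasure P)
        (_ : OTCost c P (empMeas W) ≤ ENNReal.ofReal δ), eExp P (l β))
      = ⨆ (P : Measure α) (_ : IsProbabilityMeasure P)
        (_ : OTCost c P (empMeas W) ≤ ENNReal.ofReal δ), ⨅ β : Fin d → ℝ, eExp P (l β) := by
  classical
  cases nonempty_fintype ι
  simp only [fun P β => eExp_of_nonneg P (hl0 β)]
  apply le_antisymm
  swap
  · refine le_iInf fun β => iSup_mono fun P => iSup_mono fun _ => iSup_mono fun _ => iInf_le _ β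
  refine le_of_forall_lt fun t ht => ?_
  obtain ⟨t₁, htt₁, ht₁⟩ := exists_between ht
  obtain ⟨S, hS₁, hS⟩ := EReal.exists_between_coe_real ht₁
  obtain ⟨T, hST, hT⟩ := EReal.exists_between_coe_real hS
  rw [EReal.coe_lt_coe_iff] at hST
  refine (htt₁.trans hS₁).trans_le ?_
  let I := {P : Measure α // IsProbabilityMeasure P ∧ OTCost c P (empMeas W) ≤ ENNReal.ofReal δ}
  suffices h : ∃ P : I, ∀ β, ENNReal.ofReal S ≤ ∫⁻ z, ENNReal.ofReal (l β z) ∂P.1 by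
    obtain ⟨P, hP⟩ := h
    refine le_iSup_of_le P.1 (le_iSup_of_le P.2.1 (le_iSup_of_le P.2.2 (le_iInf fun β => ?_)))
    refine le_trans ?_ (EReal.coe_ennreal_le_coe_ennreal_iff.2 (hP β))
    rw [EReal.coe_ennreal_ofReal]
    exact_mod_cast le_max_left S 0
  have hWI : OTCost c (empMeas W) (empMeas W) ≤ ENNReal.ofReal δ :=
    (OTCost_empMeas_le hn c W W).trans (by simp [hcW])
  rcases lt_or_ge S 0 with hS0 | hS0
  · exact ⟨⟨empMeas W, isProbabilityMeasure_empMeas hn W, hWI⟩, fun β => by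
      simp [ENNReal.ofReal_of_nonpos hS0.le]⟩
  have hex : ∀ β, ∃ P : I, ENNReal.ofReal T < ∫⁻ z, ENNReal.ofReal (l β z) ∂P.1 := by
    intro β
    have := hT.trans_le (iInf_le _ β)
    simp only [lt_iSup_iff] at this
    obtain ⟨P, h1, h2, h3⟩ := this
    refine ⟨⟨P, h1, h2⟩, ?_⟩
    rwa [← EReal.coe_ennreal_lt_coe_ennreal_iff, EReal.coe_ennreal_ofReal,
      max_eq_left (hS0.trans hST.le)]
  have hcoer : ∀ k, ∃ P : I, ∃ M : ℝ, ∀ β,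
      ∫⁻ z, ENNReal.ofReal (l β z) ∂P.1 ≤ ENNReal.ofReal T → l β (a k) ≤ M := by
    intro k
    obtain ⟨P, h1, h2, r, hr0, hrt, hr⟩ := exists_mem_OTCost_ball_lintegral_ge hn hcW (ha k) hδ
    refine ⟨⟨P, h1, h2⟩, (r⁻¹ * ENNReal.ofReal T).toReal, fun β hβ => ?_⟩
    rw [← ENNReal.ofReal_le_iff_le_toReal
      (ENNReal.mul_ne_top (ENNReal.inv_ne_top.2 hr0) ENNReal.ofReal_ne_top)]
    have := (hr fun z => ENNReal.ofReal (l β z)).trans hβ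
    rwa [mul_comm r⁻¹, ← div_eq_mul_inv, ENNReal.le_div_iff_mul_le (.inl hr0) (.inl hrt), mul_comm]
  choose R M hRM using hcoer
  let L : I → Set (Fin d → ℝ) := fun P =>
    {β | ∫⁻ z, ENNReal.ofReal (l β z) ∂P.1 ≤ ENNReal.ofReal T}
  obtain ⟨M', hM'⟩ : ∃ M', ∀ k, M k ≤ M' := by
    obtain ⟨M', h⟩ := (Set.finite_range M).bddAbove
    exact ⟨M', fun k => h ⟨k, rfl⟩⟩
  obtain ⟨u, hu⟩ := (hbdd M').isCompact_closure.elim_finite_subfamily_closed L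
    (fun P => isClosed_setOf_lintegral_ofReal_le P.1 hmeas hcont _) (by
      refine Set.eq_empty_of_forall_notMem fun β hβ => ?_
      obtain ⟨P, hP⟩ := hex β
      exact absurd (Set.mem_iInter.1 hβ.2 P) (not_le.2 hP))
  let v : Finset I := u ∪ Finset.univ.image R
  have hv : ∀ β, ∃ P : v, ENNReal.ofReal T < ∫⁻ z, ENNReal.ofReal (l β z) ∂P.1.1 := by
    intro β
    by_contra! hβ
    have : β ∈ closure {β | ∀ k, l β (a k) ≤ M'} ∩ ⋂ P ∈ u, L P := by
      refine ⟨subset_closure fun k => (hRM k β (hβ ⟨R k, by simp [v]⟩)).trans (hM' k), ?_⟩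
      simp only [Set.mem_iInter]
      exact fun P hP => hβ ⟨P, Finset.mem_union_left _ hP⟩
    rw [hu] at this
    exact this
  obtain ⟨w, hw, hwS⟩ := exists_stdSimplex_le_sum_of_convex_ennreal
    (f := fun (P : v) β => ∫⁻ z, ENNReal.ofReal (l β z) ∂P.1.1) (fun P x y s t hs ht hst => by
      rw [← lintegral_const_mul _ (hmeas _).ennreal_ofReal,
        ← lintegral_const_mul _ (hmeas _).ennreal_ofReal,
        ← lintegral_add_left ((hmeas _).ennreal_ofReal.const_mul _)]
      refine lintegral_mono fun z => ?_
      rw [← ENNReal.ofReal_mul hs, ← ENNReal.ofReal_mul ht, ← ENNReal.ofReal_add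
        (mul_nonneg hs (hl0 _ _)) (mul_nonneg ht (hl0 _ _))]
      exact ENNReal.ofReal_le_ofReal ((hconv z).2 trivial trivial hs ht hst)) hS0 hST hv
  have hw1 : ∑ P : v, ENNReal.ofReal (w P) = 1 := by
    rw [← ENNReal.ofReal_sum_of_nonneg fun P _ => hw.1 P, hw.2, ENNReal.ofReal_one]
  have hpr : ∀ P : v, IsProbabilityMeasure P.1.1 := fun P => P.1.2.1
  refine ⟨⟨∑ P : v, ENNReal.ofReal (w P) • P.1.1,
    isProbabilityMeasure_sum_smul hw1 fun P : v => P.1.1, ?_⟩, fun β => (hwS β).trans_eq ?_⟩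
  · refine (OTCost_sum_smul_le (D := fun _ => ENNReal.ofReal δ) hw1
      (fun _ => ENNReal.ofReal_ne_top) fun P => P.1.2.2).trans ?_
    rw [← Finset.sum_mul, hw1, one_mul]
  · rw [lintegral_finsetSum_measure]
    simp [lintegral_smul_measure]

theorem lpNorm_zero_of_one_le {q : ℝ≥0∞} (hq : 1 ≤ q) {d : ℕ} :
    _root_.lpNorm q (0 : Fin d → ℝ) = 0 := by
  unfold _root_.lpNorm
  split_ifs with h
  · simp
  · have : q.toReal ≠ 0 := (ENNReal.toReal_pos (zero_lt_one.trans_le hq).ne' h).ne'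
    simp [Real.zero_rpow this, Real.zero_rpow (inv_ne_zero this)]

theorem convexOn_log_one_add_exp : ConvexOn ℝ Set.univ fun t : ℝ => Real.log (1 + Real.exp t) := by
  have hd : ∀ t : ℝ, HasDerivAt (fun t : ℝ => Real.log (1 + Real.exp t))
      (Real.exp t / (1 + Real.exp t)) t := fun t =>
    ((Real.hasDerivAt_exp t).const_add 1).log (by positivity)
  refine Monotone.convexOn_univ_of_deriv (fun t => (hd t).differentiableAt) ?_
  intro s t hst
  rw [(hd s).deriv, (hd t).deriv, div_le_div_iff₀ (by positivity) (by positivity)]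
  have := Real.exp_le_exp.2 hst
  nlinarith

/-- If the cost forbids changing the second coordinate and all atoms have second coordinate zero,
then every measure at finite transport cost has second coordinate zero almost surely. -/
theorem ae_snd_eq_zero_of_OTCost_ne_top {E : Type*} [MeasurableSpace E] {n : ℕ}
    {c : E × ℝ → E × ℝ → ℝ≥0∞} (hc : ∀ z w, z.2 ≠ w.2 → c z w = ⊤) {W : Fin n → E × ℝ}
    (hW : ∀ i, (W i).2 = 0) {P : Measure (E × ℝ)} (hP : OTCost c P (empMeas W) ≠ ⊤) :
    ∀ᵐ z ∂P, z.2 = 0 := by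
  have h := hP.lt_top
  simp only [OTCost, iInf_lt_iff] at h
  obtain ⟨π, _, h1, h2, h3⟩ := h
  have hne : MeasurableSet {z : (E × ℝ) × (E × ℝ) | z.1.2 ≠ z.2.2} :=
    (measurableSet_eq_fun (by fun_prop) (by fun_prop)).compl
  have heq : ∀ᵐ z ∂π, z.1.2 = z.2.2 := by
    rw [ae_iff]
    by_contra h0
    refine h3.not_ge ?_
    calc (⊤ : ℝ≥0∞) = ⊤ * π {z | z.1.2 ≠ z.2.2} := (ENNReal.top_mul h0).symm
      _ = ∫⁻ z, Set.indicator {z : (E × ℝ) × (E × ℝ) | z.1.2 ≠ z.2.2} (fun _ => ⊤) z ∂π := by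
          rw [lintegral_indicator_const hne]
      _ ≤ _ := lintegral_mono fun z => by
          by_cases hz : z.1.2 = z.2.2
          · simp [hz]
          · simp [hz, hc _ _ hz]
  have hz0 : MeasurableSet {z : E × ℝ | z.2 = 0} :=
    measurable_snd (measurableSet_singleton (0 : ℝ))
  have hsnd : ∀ᵐ z ∂π, z.2.2 = 0 := by
    have : ∀ᵐ z ∂(π.map Prod.snd), z.2 = 0 := by
      rw [h2, ae_iff, ← Set.compl_ofPred]
      simp [empMeas, Measure.dirac_apply' _ hz0.compl, hW]
    exact (ae_map_iff measurable_snd.aemeasurable hz0).1 this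
  rw [← h1, ae_map_iff measurable_fst.aemeasurable hz0]
  filter_upwards [heq, hsnd] with z hz hz' using hz.trans hz'

/-- The signed coordinate vectors, attached to the label `y`. -/
def signedCoord {d : ℕ} (y : ℝ) (k : Fin d × Bool) : (Fin d → ℝ) × ℝ :=
  (Pi.single k.1 (if k.2 then 1 else -1), y)

theorem isBounded_of_forall_abs_le {d : ℕ} {s : Set (Fin d → ℝ)} {B : ℝ}
    (h : ∀ β ∈ s, ∀ j, |β j| ≤ B) : Bornology.IsBounded s := by
  refine (Metric.isBounded_Icc (fun _ : Fin d => -B) fun _ => B).subset fun β hβ => ?_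
  exact ⟨fun j => (abs_le.1 (h β hβ j)).1, fun j => (abs_le.1 (h β hβ j)).2⟩

/-- in the settings of the distributionally robust representations for
generalized LASSO (square loss, cost `N_q²` with `q ∈ (1,∞]`) and for regularized logistic
regression (log-exponential loss, cost `N_q` with `q ∈ [1,∞]`), if `E‖X‖₂² < ∞` under the
data-generating distribution, then for every realization of the training samples and every
`δ > 0`, the min–max equals the max–min:
`inf_β sup_{D_c(P,P_n) ≤ δ} E_P[l] = sup_{D_c(P,P_n) ≤ δ} inf_β E_P[l]`. -/
theorem dro_minimax_exchange_lasso_logistic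
    (d n : ℕ) (hn : 0 < n)
    -- training samples obtained from a data-generating distribution μ with E‖X‖₂² < ∞
    (Ω : Type*) [MeasurableSpace Ω] (Pr : Measure Ω) [IsProbabilityMeasure Pr]
    (X : Fin n → Ω → (Fin d → ℝ)) (Y : Fin n → Ω → ℝ)
    (μ : Measure ((Fin d → ℝ) × ℝ))
    (hident : ∀ i, Measure.map (fun ω => (X i ω, Y i ω)) Pr = μ)
    (hmom : Integrable (fun z : (Fin d → ℝ) × ℝ => lpNorm 2 z.1 ^ 2) μ)
    -- the two cost functions: c₁ = N_{q₁}² (generalized LASSO), c₂ = N_{q₂} (logistic)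
    (q₁ : ℝ≥0∞) (hq₁ : 1 < q₁) (q₂ : ℝ≥0∞) (hq₂ : 1 ≤ q₂)
    (c₁ c₂ : ((Fin d → ℝ) × ℝ) → ((Fin d → ℝ) × ℝ) → ℝ≥0∞)
    (hc₁ : ∀ x y u v, c₁ (x, y) (u, v) =
      if y = v then ENNReal.ofReal (lpNorm q₁ (x - u) ^ 2) else ⊤)
    (hc₂ : ∀ x y u v, c₂ (x, y) (u, v) =
      if y = v then ENNReal.ofReal (lpNorm q₂ (x - u)) else ⊤)
    (δ : ℝ) (hδ : 0 < δ) :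
    ∀ ω : Ω,
      ((⨅ β : Fin d → ℝ,
          ⨆ (P : Measure ((Fin d → ℝ) × ℝ)) (_ : IsProbabilityMeasure P)
            (_ : OTCost c₁ P (empMeas (fun i => (X i ω, Y i ω))) ≤ ENNReal.ofReal δ),
            eExp P (fun z => (z.2 - ∑ j, β j * z.1 j) ^ 2))
        = ⨆ (P : Measure ((Fin d → ℝ) × ℝ)) (_ : IsProbabilityMeasure P)
            (_ : OTCost c₁ P (empMeas (fun i => (X i ω, Y i ω))) ≤ ENNReal.ofReal δ),
            ⨅ β : Fin d → ℝ, eExp P (fun z => (z.2 - ∑ j, β j * z.1 j) ^ 2))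
      ∧
      ((⨅ β : Fin d → ℝ,
          ⨆ (P : Measure ((Fin d → ℝ) × ℝ)) (_ : IsProbabilityMeasure P)
            (_ : OTCost c₂ P (empMeas (fun i => (X i ω, Y i ω))) ≤ ENNReal.ofReal δ),
            eExp P (fun z => Real.log (1 + Real.exp (-(z.2 * ∑ j, β j * z.1 j)))))
        = ⨆ (P : Measure ((Fin d → ℝ) × ℝ)) (_ : IsProbabilityMeasure P)
            (_ : OTCost c₂ P (empMeas (fun i => (X i ω, Y i ω))) ≤ ENNReal.ofReal δ),
            ⨅ β : Fin d → ℝ,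
              eExp P (fun z => Real.log (1 + Real.exp (-(z.2 * ∑ j, β j * z.1 j))))) := by
  intro ω
  have hlin : ∀ (x : Fin d → ℝ), IsLinearMap ℝ fun β : Fin d → ℝ => ∑ j, β j * x j := fun x =>
    ⟨fun β γ => by simp [add_mul, Finset.sum_add_distrib],
      fun a β => by simp [mul_assoc, Finset.mul_sum]⟩
  have hc₁W : ∀ i, c₁ (X i ω, Y i ω) (X i ω, Y i ω) = 0 := fun i => by
    simp [hc₁, lpNorm_zero_of_one_le hq₁.le]
  have hc₂W : ∀ i, c₂ (X i ω, Y i ω) (X i ω, Y i ω) = 0 := fun i => by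
    simp [hc₂, lpNorm_zero_of_one_le hq₂]
  constructor
  · refine iInf_iSup_eExp_eq_iSup_iInf hn (i := ⟨0, hn⟩) (a := signedCoord (Y ⟨0, hn⟩ ω)) hc₁W
      (l := fun β z => (z.2 - ∑ j, β j * z.1 j) ^ 2) (fun _ _ => sq_nonneg _)
      (fun β => by fun_prop) (fun z => by fun_prop) (fun z => ?_) (fun k => ?_) (fun T => ?_) hδ
    · have h := (even_two.convexOn_pow (𝕜 := ℝ)).comp_affineMap
        (AffineMap.const ℝ (Fin d → ℝ) z.2 - (hlin z.1).mk'.toAffineMap)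
      exact h
    · simp [signedCoord, hc₁]
    · refine isBounded_of_forall_abs_le (B := T + 1) fun β hβ j => ?_
      have h1 := hβ (j, true)
      have h2 := hβ (j, false)
      simp only [signedCoord, Pi.single_apply, mul_ite, mul_zero, Finset.sum_ite_eq',
        Finset.mem_univ, if_true, Bool.false_eq_true, if_false, mul_one, mul_neg] at h1 h2
      rw [abs_le]
      constructor <;> nlinarith [sq_nonneg (β j - 1), sq_nonneg (β j + 1), sq_nonneg (Y ⟨0, hn⟩ ω)]
  · by_cases hY : ∀ i, Y i ω = 0
    · have key : ∀ (P : Measure ((Fin d → ℝ) × ℝ)),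
          OTCost c₂ P (empMeas (fun i => (X i ω, Y i ω))) ≤ ENNReal.ofReal δ →
          ∀ β : Fin d → ℝ,
            eExp P (fun z => Real.log (1 + Real.exp (-(z.2 * ∑ j, β j * z.1 j)))) =
              eExp P fun _ => Real.log 2 := by
        intro P hP β
        have hae := ae_snd_eq_zero_of_OTCost_ne_top (c := c₂)
          (fun z w h => by rw [← Prod.mk.eta (p := z), ← Prod.mk.eta (p := w), hc₂, if_neg h])
          hY (ne_top_of_le_ne_top ENNReal.ofReal_ne_top hP)
        have h : (fun z : (Fin d → ℝ) × ℝ =>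
            Real.log (1 + Real.exp (-(z.2 * ∑ j, β j * z.1 j)))) =ᵐ[P] fun _ => Real.log 2 := by
          filter_upwards [hae] with z hz
          rw [hz, zero_mul, neg_zero, Real.exp_zero, one_add_one_eq_two]
        have h1 := lintegral_congr_ae (h.fun_comp ENNReal.ofReal)
        have h2 := lintegral_congr_ae (h.fun_comp fun t => ENNReal.ofReal (-t))
        exact congrArg₂ (fun a b : ℝ≥0∞ => (a : EReal) - b) h1 h2
      have hsup : ∀ β : Fin d → ℝ, (⨆ (P : Measure ((Fin d → ℝ) × ℝ)) (_ : IsProbabilityMeasure P)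
          (_ : OTCost c₂ P (empMeas (fun i => (X i ω, Y i ω))) ≤ ENNReal.ofReal δ),
            eExp P (fun z => Real.log (1 + Real.exp (-(z.2 * ∑ j, β j * z.1 j))))) =
          ⨆ (P : Measure ((Fin d → ℝ) × ℝ)) (_ : IsProbabilityMeasure P)
          (_ : OTCost c₂ P (empMeas (fun i => (X i ω, Y i ω))) ≤ ENNReal.ofReal δ),
            eExp P fun _ => Real.log 2 := fun β =>
        iSup_congr fun P => iSup_congr fun _ => iSup_congr fun hP => key P hP β
      rw [iInf_congr hsup, iInf_const]
      exact iSup_congr fun P => iSup_congr fun _ => iSup_congr fun hP => by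
        rw [iInf_congr (key P hP), iInf_const]
    · push Not at hY
      obtain ⟨i, hi⟩ := hY
      have hpos : ∀ t : ℝ, 0 < 1 + Real.exp t := fun t => by positivity
      refine iInf_iSup_eExp_eq_iSup_iInf hn (i := i) (a := signedCoord (Y i ω)) hc₂W
        (l := fun β z => Real.log (1 + Real.exp (-(z.2 * ∑ j, β j * z.1 j))))
        (fun _ _ => Real.log_nonneg (le_add_of_nonneg_right (Real.exp_nonneg _)))
        (fun β => by fun_prop) (fun z => ?_) (fun z => ?_) (fun k => ?_) (fun T => ?_) hδ
      · exact Continuous.log (by fun_prop) fun β => (hpos _).ne'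
      · have h := convexOn_log_one_add_exp.comp_affineMap (-(z.2 • (hlin z.1).mk'.toAffineMap))
        exact h
      · simp [signedCoord, hc₂]
      · refine isBounded_of_forall_abs_le (B := T / |Y i ω|) fun β hβ j => ?_
        have hexp : ∀ t : ℝ, t ≤ Real.log (1 + Real.exp t) := fun t => by
          rw [Real.le_log_iff_exp_le (hpos t)]; linarith
        have h1 := (hexp _).trans (hβ (j, true))
        have h2 := (hexp _).trans (hβ (j, false))
        simp only [signedCoord, Pi.single_apply, mul_ite, mul_zero, Finset.sum_ite_eq',
          Finset.mem_univ, if_true, Bool.false_eq_true, if_false, mul_one, mul_neg] at h1 h2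
        rw [le_div_iff₀ (abs_pos.2 hi), ← abs_mul, abs_le]
        constructor <;> linarith
end
end

section
/- Let X be a random vector in ℝ^d with E‖X‖_2^2 < ∞, let e be a real random variable independent of X with 0 < E[e^2] = σ^2 < ∞ and E[e^2] − (E|e|)^2 > 0, let β ∈ ℝ^d, and let p, q ≥ 1 satisfy 1/p + 1/q = 1. Then for every z ∈ ℝ^d, sup_{ξ ∈ ℝ^d} { 2σ ξᵀz − E‖e ξ − (ξᵀX) β‖_p^2 } ≤ σ^2 ‖z‖_q^2 / (E[e^2] − (E|e|)^2). In particular, the lower bound inf_{‖ξ‖_p = 1} E‖e ξ − (ξᵀX) β‖_p^2 ≥ E[e^2] − (E|e|)^2 holds. -/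
open MeasureTheory ProbabilityTheory Filter
open scoped ENNReal NNReal Topology

noncomputable section

theorem lpNorm_eq_norm_toLp (p : ℝ≥0∞) [Fact (1 ≤ p)] {d : ℕ} (x : Fin d → ℝ) :
    _root_.lpNorm p x = ‖WithLp.toLp p x‖ := by
  unfold _root_.lpNorm
  split_ifs with h
  · subst h
    simp [PiLp.norm_eq_ciSup]
  · have hp : 0 < p.toReal :=
      ENNReal.toReal_pos (zero_lt_one.trans_le (Fact.out : 1 ≤ p)).ne' h
    simp [PiLp.norm_eq_sum hp]

theorem sum_mul_le_lpNorm_one_mul_lpNorm_top {d : ℕ} (x y : Fin d → ℝ) :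
    ∑ j, x j * y j ≤ _root_.lpNorm 1 x * _root_.lpNorm ⊤ y := by
  simp only [_root_.lpNorm, ENNReal.one_ne_top, if_false, if_true, ENNReal.toReal_one,
    Real.rpow_one, div_one, Finset.sum_mul]
  refine Finset.sum_le_sum fun j _ => ?_
  calc x j * y j ≤ |x j| * |y j| := by rw [← abs_mul]; exact le_abs_self _
    _ ≤ |x j| * ⨆ i, |y i| := by
      gcongr
      exact le_ciSup (f := fun i => |y i|) (Set.finite_range _).bddAbove j

/-- Hölder's inequality on `ℝ^d`, endpoints included. -/
theorem sum_mul_le_lpNorm_mul_lpNorm {d : ℕ} {p q : ℝ≥0∞} (hp : 1 ≤ p) (hq : 1 ≤ q)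
    (hpq : p⁻¹ + q⁻¹ = 1) (x y : Fin d → ℝ) :
    ∑ j, x j * y j ≤ _root_.lpNorm p x * _root_.lpNorm q y := by
  by_cases hpt : p = ⊤
  · subst hpt
    obtain rfl : q = 1 := by simpa using hpq
    simpa only [mul_comm] using sum_mul_le_lpNorm_one_mul_lpNorm_top y x
  by_cases hqt : q = ⊤
  · subst hqt
    obtain rfl : p = 1 := by simpa using hpq
    exact sum_mul_le_lpNorm_one_mul_lpNorm_top x y
  have hp0 : 0 < p.toReal := ENNReal.toReal_pos (zero_lt_one.trans_le hp).ne' hpt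
  have hq0 : 0 < q.toReal := ENNReal.toReal_pos (zero_lt_one.trans_le hq).ne' hqt
  have hconj : p.toReal.HolderConjugate q.toReal := by
    refine ⟨?_, hp0, hq0⟩
    have h := congrArg ENNReal.toReal hpq
    rwa [ENNReal.toReal_add (by simpa using (zero_lt_one.trans_le hp).ne')
      (by simpa using (zero_lt_one.trans_le hq).ne'), ENNReal.toReal_inv, ENNReal.toReal_inv,
      ENNReal.toReal_one, ← inv_one] at h
  simpa only [_root_.lpNorm, hpt, hqt, if_false] using
    Real.inner_le_Lp_mul_Lq Finset.univ x y hconj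

/-- The distance from `|e| * a` to any constant `b` in mean square is at least `a²` times the
variance of `|e|`. -/
theorem sq_mul_variance_abs_le_integral_sq {ν : Measure ℝ} [IsProbabilityMeasure ν]
    (hν : Integrable (fun t => t ^ 2) ν) (a b : ℝ) :
    a ^ 2 * ((∫ t, t ^ 2 ∂ν) - (∫ t, |t| ∂ν) ^ 2) ≤ ∫ t, (|t| * a - b) ^ 2 ∂ν := by
  have habs : Integrable (fun t : ℝ => |t|) ν :=
    ((memLp_two_iff_integrable_sq (by fun_prop)).2 hν |>.integrable one_le_two).abs
  have hexp : ∀ t : ℝ, (|t| * a - b) ^ 2 = a ^ 2 * t ^ 2 - 2 * a * b * |t| + b ^ 2 := fun t => by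
    rw [← sq_abs t]; ring
  have h2 := hν.const_mul (a ^ 2)
  have h1 := habs.const_mul (2 * a * b)
  have hsub : Integrable (fun t : ℝ => a ^ 2 * t ^ 2 - 2 * a * b * |t|) ν := h2.sub h1
  simp only [hexp]
  rw [integral_add hsub (integrable_const _), integral_sub h2 h1, integral_const_mul,
    integral_const_mul]
  simp only [integral_const, probReal_univ, one_smul]
  nlinarith [sq_nonneg (a * (∫ t, |t| ∂ν) - b)]

theorem integrable_lpNorm_sq_residual {d : ℕ} (p : ℝ≥0∞) [Fact (1 ≤ p)]
    {μ : Measure (Fin d → ℝ)} [IsProbabilityMeasure μ] {ν : Measure ℝ} [IsProbabilityMeasure ν]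
    (hμ : Integrable (fun x => _root_.lpNorm 2 x ^ 2) μ) (hν : Integrable (fun t => t ^ 2) ν)
    (β ξ : Fin d → ℝ) :
    Integrable (fun w : (Fin d → ℝ) × ℝ =>
      _root_.lpNorm p (w.2 • ξ - (∑ j, ξ j * w.1 j) • β) ^ 2) (μ.prod ν) := by
  have hbound : Integrable (fun w : (Fin d → ℝ) × ℝ =>
      2 * _root_.lpNorm p ξ ^ 2 * w.2 ^ 2
        + 2 * _root_.lpNorm p β ^ 2 * _root_.lpNorm 2 ξ ^ 2 * _root_.lpNorm 2 w.1 ^ 2)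
      (μ.prod ν) :=
    ((hν.comp_snd μ).const_mul _).add ((hμ.comp_fst ν).const_mul _)
  refine hbound.mono' ?_ (Eventually.of_forall fun w => ?_)
  · simp only [lpNorm_eq_norm_toLp]
    exact Continuous.aestronglyMeasurable (by fun_prop)
  have hCS : (∑ j, ξ j * w.1 j) ^ 2 ≤ _root_.lpNorm 2 ξ ^ 2 * _root_.lpNorm 2 w.1 ^ 2 := by
    simpa [lpNorm_eq_norm_toLp, EuclideanSpace.norm_sq_eq] using
      Finset.sum_mul_sq_le_sq_mul_sq Finset.univ ξ w.1
  rw [Real.norm_of_nonneg (sq_nonneg _)]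
  generalize (∑ j, ξ j * w.1 j) = c at hCS ⊢
  have htri : _root_.lpNorm p (w.2 • ξ - c • β)
      ≤ |w.2| * _root_.lpNorm p ξ + |c| * _root_.lpNorm p β := by
    simp only [lpNorm_eq_norm_toLp, WithLp.toLp_sub, WithLp.toLp_smul]
    simpa only [norm_smul, Real.norm_eq_abs] using
      norm_sub_le (w.2 • WithLp.toLp p ξ) (c • WithLp.toLp p β)
  have h0 : 0 ≤ _root_.lpNorm p (w.2 • ξ - c • β) := by
    rw [lpNorm_eq_norm_toLp]; exact norm_nonneg _
  calc _root_.lpNorm p (w.2 • ξ - c • β) ^ 2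
      ≤ (|w.2| * _root_.lpNorm p ξ + |c| * _root_.lpNorm p β) ^ 2 := by gcongr
    _ ≤ 2 * ((|w.2| * _root_.lpNorm p ξ) ^ 2 + (|c| * _root_.lpNorm p β) ^ 2) := add_sq_le
    _ = 2 * _root_.lpNorm p ξ ^ 2 * w.2 ^ 2 + 2 * _root_.lpNorm p β ^ 2 * c ^ 2 := by
      rw [mul_pow, mul_pow, sq_abs, sq_abs]; ring
    _ ≤ _ := by
      rw [mul_assoc (2 * _root_.lpNorm p β ^ 2)]
      gcongr

theorem lpNorm_sq_mul_variance_abs_le_integral {d : ℕ} (p : ℝ≥0∞) [Fact (1 ≤ p)]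
    {μ : Measure (Fin d → ℝ)} [IsProbabilityMeasure μ] {ν : Measure ℝ} [IsProbabilityMeasure ν]
    (hμ : Integrable (fun x => _root_.lpNorm 2 x ^ 2) μ) (hν : Integrable (fun t => t ^ 2) ν)
    (β ξ : Fin d → ℝ) :
    _root_.lpNorm p ξ ^ 2 * ((∫ t, t ^ 2 ∂ν) - (∫ t, |t| ∂ν) ^ 2)
      ≤ ∫ w, _root_.lpNorm p (w.2 • ξ - (∑ j, ξ j * w.1 j) • β) ^ 2 ∂(μ.prod ν) := by
  have hint := integrable_lpNorm_sq_residual p hμ hν β ξ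
  rw [integral_prod _ hint]
  refine le_trans (by simp) (integral_mono_ae (integrable_const
    (_root_.lpNorm p ξ ^ 2 * ((∫ t, t ^ 2 ∂ν) - (∫ t, |t| ∂ν) ^ 2))) hint.integral_prod_left ?_)
  filter_upwards [hint.prod_right_ae] with x hx
  refine (sq_mul_variance_abs_le_integral_sq hν (_root_.lpNorm p ξ)
    (|∑ j, ξ j * x j| * _root_.lpNorm p β)).trans ?_
  refine integral_mono_of_nonneg (Eventually.of_forall fun t => sq_nonneg _) hx
    (Eventually.of_forall fun t => ?_)
  simp only [lpNorm_eq_norm_toLp, WithLp.toLp_sub, WithLp.toLp_smul]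
  rw [← sq_abs]
  gcongr
  simpa only [norm_smul, Real.norm_eq_abs] using
    abs_norm_sub_norm_le (t • WithLp.toLp p ξ) ((∑ j, ξ j * x j) • WithLp.toLp p β)

/-- the key deterministic inequality behind stochastic dominance of the limit
law in the RWP analysis for linear regression. `X` has law `μX` with `E‖X‖₂² < ∞`; `e` has
law `νe`, is independent of `X` (expectations are under the product law), `E[e²] = σ² > 0`
and `E[e²] - (E|e|)² > 0`. Then for every `z`,
`sup_ξ { 2σ ξᵀz - E‖eξ - (ξᵀX)β‖_p² } ≤ σ² ‖z‖_q² / (E[e²] - (E|e|)²)`, and the lower bound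
`inf_{‖ξ‖_p = 1} E‖eξ - (ξᵀX)β‖_p² ≥ E[e²] - (E|e|)²` holds. -/
theorem linear_regression_rwp_dominance_inequality
    (d : ℕ) (p q : ℝ≥0∞) (hp : 1 ≤ p) (hq : 1 ≤ q) (hpq : p⁻¹ + q⁻¹ = 1)
    (μX : Measure (Fin d → ℝ)) [IsProbabilityMeasure μX]
    (νe : Measure ℝ) [IsProbabilityMeasure νe]
    (hXmom : Integrable (fun x => lpNorm 2 x ^ 2) μX)
    (hemom : Integrable (fun t => t ^ 2) νe)
    (σ : ℝ) (hσpos : 0 < σ) (hσ2 : (∫ t, t ^ 2 ∂νe) = σ ^ 2)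
    (hvar : 0 < (∫ t, t ^ 2 ∂νe) - (∫ t, |t| ∂νe) ^ 2)
    (β : Fin d → ℝ) :
    (∀ z ξ : Fin d → ℝ,
      2 * σ * (∑ j, ξ j * z j)
          - ∫ w, lpNorm p (w.2 • ξ - (∑ j, ξ j * w.1 j) • β) ^ 2 ∂(μX.prod νe)
        ≤ σ ^ 2 * lpNorm q z ^ 2 / ((∫ t, t ^ 2 ∂νe) - (∫ t, |t| ∂νe) ^ 2))
    ∧ (∀ ξ : Fin d → ℝ, lpNorm p ξ = 1 →
        (∫ t, t ^ 2 ∂νe) - (∫ t, |t| ∂νe) ^ 2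
          ≤ ∫ w, lpNorm p (w.2 • ξ - (∑ j, ξ j * w.1 j) • β) ^ 2 ∂(μX.prod νe)) := by
  have : Fact (1 ≤ p) := ⟨hp⟩
  refine ⟨fun z ξ => ?_, fun ξ hξ => ?_⟩
  · have hlow := lpNorm_sq_mul_variance_abs_le_integral p hXmom hemom β ξ
    have hhol := mul_le_mul_of_nonneg_left (sum_mul_le_lpNorm_mul_lpNorm hp hq hpq ξ z) hσpos.le
    rw [le_div_iff₀ hvar]
    set V := (∫ t, t ^ 2 ∂νe) - (∫ t, |t| ∂νe) ^ 2
    have hgap : 2 * σ * (∑ j, ξ j * z j)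
          - ∫ w, _root_.lpNorm p (w.2 • ξ - (∑ j, ξ j * w.1 j) • β) ^ 2 ∂(μX.prod νe)
        ≤ 2 * (σ * (_root_.lpNorm p ξ * _root_.lpNorm q z)) - _root_.lpNorm p ξ ^ 2 * V := by
      linarith
    refine (mul_le_mul_of_nonneg_right hgap hvar.le).trans ?_
    nlinarith [sq_nonneg (_root_.lpNorm p ξ * V - σ * _root_.lpNorm q z)]
  · simpa [hξ] using lpNorm_sq_mul_variance_abs_le_integral p hXmom hemom β ξ
end
end
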